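/- arXiv:2001.05641 — 3 statements merged into one kernel-verified Lean document; each statement's English description precedes it below -/
import Mathlib

section
/- Let q be an odd prime power and let f be a monic polynomial in 𝔽_q[T]. Then μ(f) = (-1)^{deg f} · χ(disc f), where χ is the quadratic character on 𝔽_q and disc f is the discriminant of f. -/
open Polynomial

open scoped Classical

/-- The Möbius function on polynomials over a field: `μ f = (-1)^r` if `f` is squarefree
(i.e. a product of `r` distinct irreducible factors), and `0` otherwise. -/
noncomputable def polyMoebius {K : Type*} [Field K] (f : K[X]) : ℤ :=
  if Squarefree f then (-1) ^ (UniqueFactorizationMonoid.normalizedFactors f).card else 0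

open Equiv.Perm in
/-- If the fibres of `g` are exactly the orbits of a permutation `σ`, then the sign of `σ` is
`(-1)` to the number of points plus the number of orbits. -/
theorem sign_eq_neg_one_pow_card_add_card_image {α β : Type*} [Fintype α] [DecidableEq α] [DecidableEq β]
    (σ : Equiv.Perm α)
    (g : α → β) (hg : ∀ x y, g x = g y ↔ σ.SameCycle x y) :
    Equiv.Perm.sign σ = (-1) ^ (Fintype.card α + (Finset.univ.image g).card) := by
  have hsupp : (σ.support.image g).card = σ.cycleFactorsFinset.card := by
    have hc : σ.support.image σ.cycleOf = σ.cycleFactorsFinset := by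
      ext c
      simp only [Finset.mem_image]
      constructor
      · rintro ⟨x, hx, rfl⟩
        exact cycleOf_mem_cycleFactorsFinset_iff.2 hx
      · intro hc
        obtain ⟨x, hx⟩ := (mem_cycleFactorsFinset_iff.1 hc).1.nonempty_support
        exact ⟨x, mem_cycleFactorsFinset_support_le hc hx, (cycle_is_cycleOf hx hc).symm⟩
    have h₁ : (σ.support.image fun x => (g x, σ.cycleOf x)).card = (σ.support.image g).card := by
      rw [← Finset.card_image_of_injOn (f := Prod.fst), Finset.image_image]
      · rfl
      · intro a ha b hb hab
        obtain ⟨x, hx, rfl⟩ := Finset.mem_image.1 ha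
        obtain ⟨y, hy, rfl⟩ := Finset.mem_image.1 hb
        exact Prod.ext hab ((hg x y).1 hab).cycleOf_eq
    have h₂ : (σ.support.image fun x => (g x, σ.cycleOf x)).card =
        (σ.support.image σ.cycleOf).card := by
      rw [← Finset.card_image_of_injOn (f := Prod.snd), Finset.image_image]
      · rfl
      · intro a ha b hb hab
        obtain ⟨x, hx, rfl⟩ := Finset.mem_image.1 ha
        obtain ⟨y, hy, rfl⟩ := Finset.mem_image.1 hb
        exact Prod.ext ((hg x y).2 ((sameCycle_iff_cycleOf_eq_of_mem_support hx hy).2 hab)) hab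
    rw [← h₁, h₂, hc]
  have hfix : (σ.supportᶜ.image g).card = σ.supportᶜ.card := by
    refine Finset.card_image_of_injOn fun x hx y _ hxy => ?_
    have hx' : Function.IsFixedPt σ x := by simpa [Function.IsFixedPt] using hx
    exact ((hg x y).1 hxy).eq_of_left hx'
  have hdisj : Disjoint (σ.support.image g) (σ.supportᶜ.image g) := by
    rw [Finset.disjoint_left]
    intro p hp hq
    obtain ⟨x, hx, rfl⟩ := Finset.mem_image.1 hp
    obtain ⟨y, hy, hyx⟩ := Finset.mem_image.1 hq
    have hy' : Function.IsFixedPt σ y := by simpa [Function.IsFixedPt] using hy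
    exact Finset.mem_compl.1 hy (((hg y x).1 hyx).eq_of_left hy' ▸ hx)
  have himage : (Finset.univ.image g).card = σ.cycleFactorsFinset.card + σ.supportᶜ.card := by
    rw [← Finset.union_compl σ.support, Finset.image_union, Finset.card_union_of_disjoint hdisj,
      hsupp, hfix]
  have hcard := Finset.card_add_card_compl σ.support
  have htype : Multiset.card σ.cycleType = σ.cycleFactorsFinset.card := by
    simp [cycleType]
  rw [sign_of_cycleType, sum_cycleType, htype, himage, ← hcard]
  have : σ.support.card + σ.supportᶜ.card + (σ.cycleFactorsFinset.card + σ.supportᶜ.card) =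
      σ.support.card + σ.cycleFactorsFinset.card + 2 * σ.supportᶜ.card := by ring
  rw [this, pow_add _ _ (2 * _), pow_mul]
  simp

/-- Two elements of a normal extension of a finite field have the same minimal
polynomial iff one is an iterated Frobenius image of the other. -/
theorem minpoly_eq_iff_exists_pow_card_pow {K L : Type*} [Field K] [Fintype K] [Field L]
    [Algebra K L] [Normal K L] (x y : L) :
    minpoly K x = minpoly K y ↔ ∃ n : ℕ, x ^ Fintype.card K ^ n = y := by
  constructor
  · intro h
    obtain ⟨s, hs⟩ := IsConjRoot.exists_algEquiv (K := K) (IsConjRoot.symm h)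
    have hint : IsIntegral K x := Algebra.IsIntegral.isIntegral x
    have : FiniteDimensional K (IntermediateField.adjoin K {x}) :=
      IntermediateField.adjoin.finiteDimensional hint
    have : Finite (IntermediateField.adjoin K {x}) := Module.finite_of_finite K
    obtain ⟨n, hn⟩ := (FiniteField.bijective_frobeniusAlgEquivOfAlgebraic_pow K
      (IntermediateField.adjoin K {x})).2 (s.restrictNormal (IntermediateField.adjoin K {x}))
    refine ⟨n, ?_⟩
    have key := s.restrictNormal_commutes (IntermediateField.adjoin K {x})
      (IntermediateField.AdjoinSimple.gen K x)
    rw [← hn, AlgEquiv.coe_pow, FiniteField.coe_frobeniusAlgEquivOfAlgebraic_iterate] at key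
    simpa [hs] using key
  · rintro ⟨n, rfl⟩
    have := minpoly.algEquiv_eq ((FiniteField.frobeniusAlgEquivOfAlgebraic K L) ^ n) x
    rw [AlgEquiv.coe_pow, FiniteField.coe_frobeniusAlgEquivOfAlgebraic_iterate] at this
    exact this.symm

theorem aeval_eq_zero_iff_exists_of_map_eq_prod {K L ι : Type*} [Field K] [Field L] [Algebra K L]
    [Fintype ι] {f : K[X]} (r : ι → L) (hr : f.map (algebraMap K L) = ∏ i, (X - C (r i))) (x : L) :
    aeval x f = 0 ↔ ∃ i, r i = x := by
  rw [aeval_def, ← eval_map, hr, eval_prod, Finset.prod_eq_zero_iff]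
  simp [sub_eq_zero, eq_comm]

/-- The distinct minimal polynomials of the roots of a squarefree monic polynomial are its
irreducible factors. -/
theorem card_image_minpoly_eq_card_normalizedFactors {K L ι : Type*} [Field K] [Field L]
    [Algebra K L] [IsAlgClosed L] [Fintype ι] {f : K[X]} (hsq : Squarefree f) (r : ι → L)
    (hr : f.map (algebraMap K L) = ∏ i, (X - C (r i))) :
    (Finset.univ.image fun i => minpoly K (r i)).card =
      (UniqueFactorizationMonoid.normalizedFactors f).card := by
  have hroot := aeval_eq_zero_iff_exists_of_map_eq_prod r hr
  have hint (i : ι) : IsIntegral K (r i) :=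
    IsAlgebraic.isIntegral ⟨f, hsq.ne_zero, (hroot _).2 ⟨i, rfl⟩⟩
  rw [← Multiset.toFinset_card_of_nodup
    ((UniqueFactorizationMonoid.squarefree_iff_nodup_normalizedFactors hsq.ne_zero).1 hsq)]
  congr 1
  ext p
  rw [Multiset.mem_toFinset, Polynomial.mem_normalizedFactors_iff hsq.ne_zero]
  simp only [Finset.mem_image, Finset.mem_univ, true_and]
  constructor
  · rintro ⟨i, rfl⟩
    exact ⟨minpoly.irreducible (hint i), minpoly.monic (hint i),
      minpoly.dvd _ _ ((hroot _).2 ⟨i, rfl⟩)⟩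
  · rintro ⟨hirr, hmon, hdvd⟩
    obtain ⟨x, hx⟩ := IsAlgClosed.exists_aeval_eq_zero L p hirr.degree_pos.ne'
    obtain ⟨i, rfl⟩ := (hroot x).1 (aeval_eq_zero_of_dvd_aeval_eq_zero hdvd hx)
    exact ⟨i, (minpoly.eq_of_irreducible_of_monic hirr hx hmon).symm⟩

/-- The Frobenius permutation of the roots of a polynomial over a finite field. -/
theorem exists_perm_pow_card {K L ι : Type*} [Field K] [Fintype K] [Field L] [Algebra K L]
    [Fintype ι] {f : K[X]} (r : ι → L) (hinj : Function.Injective r)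
    (hr : f.map (algebraMap K L) = ∏ i, (X - C (r i))) :
    ∃ σ : Equiv.Perm ι, ∀ i, r (σ i) = r i ^ Fintype.card K := by
  have hroot := aeval_eq_zero_iff_exists_of_map_eq_prod r hr
  have hex (i : ι) : ∃ j, r j = r i ^ Fintype.card K := by
    rw [← hroot, ← FiniteField.frobeniusAlgHom_apply K L, aeval_algHom_apply,
      (hroot _).2 ⟨i, rfl⟩, map_zero]
  choose s hs using hex
  have hsinj : Function.Injective s := fun i j hij => hinj <|
    (FiniteField.frobeniusAlgHom K L).injective <| by
      change r i ^ Fintype.card K = r j ^ Fintype.card K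
      rw [← hs, ← hs, hij]
  exact ⟨Equiv.ofBijective s (Finite.injective_iff_bijective.1 hsinj), hs⟩

/-- The quadratic character of the discriminant is the sign of the Frobenius permutation of the
roots. -/
theorem quadraticChar_eq_sign {K L : Type*} [Field K] [Fintype K] [Field L] [Algebra K L] {n : ℕ}
    (hodd : Odd (Fintype.card K)) (r : Fin n → L) (hinj : Function.Injective r)
    (σ : Equiv.Perm (Fin n)) (hσ : ∀ i, r (σ i) = r i ^ Fintype.card K) (d : K)
    (hd : algebraMap K L d = ∏ i, ∏ j ∈ Finset.Ioi i, (r i - r j) ^ 2) :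
    quadraticChar K d = Equiv.Perm.sign σ := by
  have hchar : ringChar K ≠ 2 := fun h =>
    (Nat.not_even_iff_odd.2 hodd) (FiniteField.even_card_iff_char_two.1 h |> Nat.even_iff.2)
  set δ : L := ∏ i, ∏ j ∈ Finset.Ioi i, (r i - r j) with hδ
  have hδ0 : δ ≠ 0 := by
    refine Finset.prod_ne_zero_iff.2 fun i _ => Finset.prod_ne_zero_iff.2 fun j hj => ?_
    exact sub_ne_zero.2 (hinj.ne (Finset.mem_Ioi.1 hj).ne)
  have hδd : algebraMap K L d = δ ^ 2 := by simp_rw [hd, hδ, Finset.prod_pow]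
  have hd0 : d ≠ 0 := by
    rintro rfl
    exact pow_ne_zero 2 hδ0 (by rw [← hδd, map_zero])
  have hfrob : δ ^ Fintype.card K = Equiv.Perm.sign σ * δ := by
    rw [hδ, ← σ.prod_Ioi_comp_eq_sign_mul_prod (f := fun i j => r i - r j) (by simp),
      ← FiniteField.frobeniusAlgHom_apply K L]
    simp_rw [map_prod, map_sub, FiniteField.frobeniusAlgHom_apply, hσ]
  have hL : ((quadraticChar K d : ℤ) : L) = ((Equiv.Perm.sign σ : ℤ) : L) := by
    apply mul_right_cancel₀ hδ0
    rw [← hfrob, ← map_intCast (algebraMap K L),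
      quadraticChar_eq_pow_of_char_ne_two' hchar, map_pow, hδd, ← pow_mul, ← pow_succ,
      Nat.two_mul_div_two_add_one_of_odd hodd]
  have h2 : (2 : L) ≠ 0 := by
    rw [← map_ofNat (algebraMap K L) 2, Ne, map_eq_zero]
    exact Ring.two_ne_zero hchar
  have hne : (-1 : L) ≠ 1 := fun h => h2 (by linear_combination -h)
  rcases quadraticChar_dichotomy hd0 with h | h <;>
    rcases Int.units_eq_one_or (Equiv.Perm.sign σ) with h' | h' <;>
    simp_all [hne.symm]

/-- **Pellet's Formula.** Let `q` be an odd prime power (realized as the cardinality of a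
finite field `F`) and let `f` be a monic polynomial in `𝔽_q[T]`, with roots
`r 0, …, r (n-1)` (with multiplicity) in an algebraic closure. Then
`μ(f) = (-1)^(deg f) * χ(disc f)`, where `χ` is the quadratic character on `𝔽_q` and
`disc f = ∏_{i<j} (r i - r j)^2` is the discriminant of `f`, an element `d` of `𝔽_q`. -/
theorem pellet_formula {F : Type*} [Field F] [Fintype F] (hodd : Odd (Fintype.card F))
    (f : F[X]) (hf : f.Monic)
    (r : Fin f.natDegree → AlgebraicClosure F)
    (hr : f.map (algebraMap F (AlgebraicClosure F)) = ∏ i, (X - C (r i)))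
    (d : F)
    (hd : algebraMap F (AlgebraicClosure F) d =
      ∏ i : Fin f.natDegree, ∏ j ∈ Finset.univ.filter (fun j => i < j), (r i - r j) ^ 2) :
    polyMoebius f = (-1) ^ f.natDegree * quadraticChar F d := by
  have hd' : algebraMap F (AlgebraicClosure F) d =
      ∏ i, ∏ j ∈ Finset.Ioi i, (r i - r j) ^ 2 := by
    rw [hd]
    refine Finset.prod_congr rfl fun i _ => Finset.prod_congr ?_ fun _ _ => rfl
    ext j
    simp
  have hsq : Squarefree f ↔ Function.Injective r := by
    rw [← PerfectField.separable_iff_squarefree, ← separable_map (algebraMap F (AlgebraicClosure F)), hr,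
      separable_prod_X_sub_C_iff]
  by_cases hinj : Function.Injective r
  · obtain ⟨σ, hσ⟩ := exists_perm_pow_card r hinj hr
    have hpow (n : ℕ) (i) : r ((σ ^ n) i) = r i ^ Fintype.card F ^ n := by
      induction n with
      | zero => simp
      | succ n ih => rw [pow_succ', Equiv.Perm.mul_apply, hσ, ih, ← pow_mul, pow_succ]
    have hcycle (i j) : minpoly F (r i) = minpoly F (r j) ↔ σ.SameCycle i j := by
      rw [minpoly_eq_iff_exists_pow_card_pow]
      simp_rw [← hpow, hinj.eq_iff]
      exact ⟨fun ⟨n, hn⟩ => ⟨n, by simpa using hn⟩, fun h => h.exists_nat_pow_eq⟩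
    rw [polyMoebius, if_pos (hsq.2 hinj), quadraticChar_eq_sign hodd r hinj σ hσ d hd',
      sign_eq_neg_one_pow_card_add_card_image σ (fun i => minpoly F (r i)) hcycle,
      card_image_minpoly_eq_card_normalizedFactors (hsq.2 hinj) r hr, Fintype.card_fin]
    push_cast
    rw [pow_add, ← mul_assoc, ← pow_add, Even.neg_one_pow ⟨_, rfl⟩, one_mul]
  · have hd0 : d = 0 := by
      obtain ⟨i, j, hij, hne⟩ := Function.not_injective_iff.1 hinj
      wlog hlt : i < j generalizing i j
      · exact this j i hij.symm hne.symm (lt_of_le_of_ne (not_lt.1 hlt) hne.symm)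
      rw [← map_eq_zero (algebraMap F (AlgebraicClosure F)), hd']
      exact Finset.prod_eq_zero (Finset.mem_univ i)
        (Finset.prod_eq_zero (Finset.mem_Ioi.2 hlt) (by simp [hij]))
    rw [polyMoebius, if_neg (hsq.not.2 hinj), hd0, MulChar.map_zero, mul_zero]
end

section
/- Let q be an odd prime power and let f be a monic squarefree polynomial in 𝔽_q[T]. Then μ(f) = (-1)^{deg f} · sign(Frob_q | f), where sign(Frob_q | f) denotes the sign of the permutation induced by the Frobenius map Frob_q on the set of roots of f in an algebraic closure of 𝔽_q. -/
open Polynomial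

open scoped Classical

open UniqueFactorizationMonoid

/-- Conjugate elements over a finite field are related by a power of Frobenius. -/
theorem IsConjRoot.exists_pow_card_pow_eq {F L : Type*} [Field F] [Fintype F] [Field L]
    [Algebra F L] [Normal F L] {x y : L} (h : IsConjRoot F x y) :
    ∃ n : ℕ, y ^ Fintype.card F ^ n = x := by
  obtain ⟨σ, rfl⟩ := h.exists_algEquiv
  let E := IntermediateField.adjoin F {y}
  have : FiniteDimensional F E :=
    IntermediateField.adjoin.finiteDimensional (Normal.isIntegral inferInstance y)
  have : Finite E := Module.finite_of_finite F
  let y' : E := ⟨y, IntermediateField.mem_adjoin_simple_self F y⟩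
  obtain ⟨n, hn⟩ :=
    (FiniteField.bijective_frobeniusAlgEquivOfAlgebraic_pow F E).surjective (σ.restrictNormal E)
  refine ⟨n, ?_⟩
  have hσ := AlgEquiv.restrictNormal_commutes σ E y'
  rw [← hn, AlgEquiv.coe_pow, FiniteField.coe_frobeniusAlgEquivOfAlgebraic_iterate,
    map_pow] at hσ
  exact hσ

/-- A transitive permutation of a nonempty finite type of cardinality `n` has sign
`(-1) ^ (n - 1)`. -/
theorem Equiv.Perm.sign_of_forall_sameCycle {α : Type*} [Fintype α] [DecidableEq α] [Nonempty α]
    (π : Equiv.Perm α) (h : ∀ x y, π.SameCycle x y) :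
    Equiv.Perm.sign π = -(-1) ^ Fintype.card α := by
  rcases subsingleton_or_nontrivial α with hα | hα
  · rw [Subsingleton.elim π 1, map_one, Fintype.card_eq_one_iff_nonempty_unique.2
      ⟨⟨Classical.arbitrary α⟩, fun _ => Subsingleton.elim _ _⟩]
    simp
  · have hne (x : α) : π x ≠ x := fun hx => by
      obtain ⟨y, hy⟩ := exists_ne x
      exact hy ((h x y).eq_of_left hx).symm
    have hc : π.IsCycle := ⟨Classical.arbitrary α, hne _, fun y _ => h _ y⟩
    rw [hc.sign, show π.support = Finset.univ by ext; simpa using hne _, Finset.card_univ]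

/-- The `q`-power map permutes the roots of a polynomial over `𝔽_q`. -/
theorem Polynomial.exists_perm_rootSet_pow_card {F L : Type*} [Field F] [Fintype F] [Field L]
    [Algebra F L] (f : F[X]) :
    ∃ π : Equiv.Perm (f.rootSet L), ∀ x, (π x : L) = (x : L) ^ Fintype.card F := by
  have hinj : Function.Injective (FiniteField.frobeniusAlgHom F L) := RingHom.injective _
  let φ : f.rootSet L → f.rootSet L := fun x => ⟨FiniteField.frobeniusAlgHom F L x, by
    have hx := mem_rootSet.1 x.2
    exact mem_rootSet.2 ⟨hx.1, by rw [aeval_algHom_apply, hx.2, map_zero]⟩⟩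
  have hφ : Function.Injective φ := fun x y hxy =>
    Subtype.ext (hinj (congrArg Subtype.val hxy))
  exact ⟨Equiv.ofBijective φ (Finite.injective_iff_bijective.1 hφ), fun x => rfl⟩

/-- The sign of Frobenius is multiplicative on coprime polynomials. -/
theorem Polynomial.sign_frobenius_mul {F L : Type*} [Field F] [Fintype F] [Field L]
    [Algebra F L] {f g : F[X]} (hf : f ≠ 0) (hg : g ≠ 0) (hfg : IsCoprime f g)
    (π : Equiv.Perm ((f * g).rootSet L)) (πf : Equiv.Perm (f.rootSet L))
    (πg : Equiv.Perm (g.rootSet L))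
    (hπ : ∀ x, (π x : L) = (x : L) ^ Fintype.card F)
    (hπf : ∀ x, (πf x : L) = (x : L) ^ Fintype.card F)
    (hπg : ∀ x, (πg x : L) = (x : L) ^ Fintype.card F) :
    Equiv.Perm.sign π = Equiv.Perm.sign πf * Equiv.Perm.sign πg := by
  have hunion : (f * g).rootSet L = f.rootSet L ∪ g.rootSet L := by
    ext x
    simp [mem_rootSet, hf, hg]
  have hdisj : Disjoint (f.rootSet L) (g.rootSet L) := by
    rw [Set.disjoint_left]
    intro x hx hx'
    obtain ⟨a, b, hab⟩ := hfg
    have := congrArg (aeval x) hab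
    simp [(mem_rootSet.1 hx).2, (mem_rootSet.1 hx').2] at this
  let e := (Equiv.setCongr hunion).trans (Equiv.Set.union hdisj)
  have he : e.symm.permCongr (Equiv.sumCongr πf πg) = π := by
    ext x
    obtain ⟨y, rfl⟩ := e.symm.surjective x
    rw [hπ, Equiv.permCongr_apply, Equiv.symm_symm, Equiv.apply_symm_apply]
    rcases y with y | y
    · exact hπf y
    · exact hπg y
  rw [← he, Equiv.Perm.sign_permCongr]
  exact Equiv.Perm.sign_sumCongr πf πg

/-- Frobenius acts on the roots of an irreducible polynomial of degree `d` as a `d`-cycle. -/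
theorem Polynomial.sign_frobenius_of_irreducible {F L : Type*} [Field F] [Fintype F] [Field L]
    [Algebra F L] [IsAlgClosure F L] {p : F[X]} (hp : Irreducible p)
    (π : Equiv.Perm (p.rootSet L)) (hπ : ∀ x, (π x : L) = (x : L) ^ Fintype.card F) :
    Equiv.Perm.sign π = -(-1) ^ p.natDegree := by
  have : IsAlgClosed L := IsAlgClosure.isAlgClosed F
  have : Normal F L := IsAlgClosure.normal F L
  obtain ⟨x, hx⟩ := IsAlgClosed.exists_aeval_eq_zero L p (degree_pos_of_irreducible hp).ne'
  have : Nonempty (p.rootSet L) := ⟨⟨x, mem_rootSet.2 ⟨hp.ne_zero, hx⟩⟩⟩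
  rw [Equiv.Perm.sign_of_forall_sameCycle π, card_rootSet_eq_natDegree
    (PerfectField.separable_of_irreducible hp) (IsAlgClosed.splits _)]
  intro x y
  have hconj : IsConjRoot F (y : L) x := by
    rw [isConjRoot_def, ← minpoly.eq_of_irreducible hp (mem_rootSet.1 x.2).2,
      ← minpoly.eq_of_irreducible hp (mem_rootSet.1 y.2).2]
  obtain ⟨n, hn⟩ := hconj.exists_pow_card_pow_eq
  refine ⟨n, Subtype.ext ?_⟩
  rw [← hn, zpow_natCast]
  clear hn
  induction n with
  | zero => simp
  | succ n ih => rw [pow_succ' π, Equiv.Perm.mul_apply, hπ, ih, ← pow_mul, pow_succ]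

/-- Pellet's formula for squarefree, not necessarily monic, polynomials. -/
theorem Polynomial.neg_one_pow_card_normalizedFactors {F L : Type*} [Field F] [Fintype F]
    [Field L] [Algebra F L] [IsAlgClosure F L] (f : F[X]) (hsf : Squarefree f)
    (π : Equiv.Perm (f.rootSet L)) (hπ : ∀ x, (π x : L) = (x : L) ^ Fintype.card F) :
    (-1 : ℤ) ^ (normalizedFactors f).card = (-1) ^ f.natDegree * (Equiv.Perm.sign π : ℤ) := by
  induction f using WfDvdMonoid.induction_on_irreducible with
  | zero => exact absurd hsf not_squarefree_zero
  | unit u hu =>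
    obtain ⟨c, -, rfl⟩ := isUnit_iff.1 hu
    have : IsEmpty ((C c).rootSet L) := by simp
    simp [normalizedFactors_of_isUnit hu, Subsingleton.elim π 1]
  | mul g p hg hp ih =>
    obtain ⟨hrel, -, hsg⟩ := squarefree_mul_iff.1 hsf
    obtain ⟨πp, hπp⟩ := exists_perm_rootSet_pow_card (L := L) p
    obtain ⟨πg, hπg⟩ := exists_perm_rootSet_pow_card (L := L) g
    rw [sign_frobenius_mul hp.ne_zero hg hrel.isCoprime π πp πg hπ hπp hπg,
      normalizedFactors_mul hp.ne_zero hg, normalizedFactors_irreducible hp,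
      natDegree_mul hp.ne_zero hg, sign_frobenius_of_irreducible hp πp hπp,
      Multiset.card_add, pow_add, ih hsg πg hπg]
    have hsq : ((-1 : ℤ) ^ p.natDegree) * (-1) ^ p.natDegree = 1 := by
      rw [← mul_pow]; simp
    push_cast [pow_add, Multiset.card_singleton]
    linear_combination (-1 : ℤ) ^ g.natDegree * (Equiv.Perm.sign πg : ℤ) * hsq

/-- **Proto-Pellet's Formula.** Let `q` be an odd prime power (realized as the cardinality
of a finite field `F`) and let `f` be a monic squarefree polynomial in `𝔽_q[T]`. If `π` is
the permutation of the set of roots of `f` in an algebraic closure of `𝔽_q` induced by the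
Frobenius map `α ↦ α^q`, then `μ(f) = (-1)^(deg f) * sign(π)`. -/
theorem proto_pellet_formula {F : Type*} [Field F] [Fintype F] (hodd : Odd (Fintype.card F))
    (f : F[X]) (hf : f.Monic) (hsf : Squarefree f)
    (π : Equiv.Perm (f.rootSet (AlgebraicClosure F)))
    (hπ : ∀ x : f.rootSet (AlgebraicClosure F),
      (π x : AlgebraicClosure F) = (x : AlgebraicClosure F) ^ Fintype.card F) :
    polyMoebius f = (-1) ^ f.natDegree * (Equiv.Perm.sign π : ℤ) := by
  rw [polyMoebius, if_pos hsf]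
  exact neg_one_pow_card_normalizedFactors f hsf π hπ
end

section
/- Let q be an odd prime power and let f ∈ 𝔽_q[T] be a monic squarefree polynomial. Then sign(Frob_q | f) = χ(disc f), where χ is the quadratic character on 𝔽_q. -/
open Polynomial

open scoped Classical

/-- The product of the squared differences of a tuple is the square of its Vandermonde
determinant. -/
theorem prod_sub_sq_eq_det_vandermonde_sq {R : Type*} [CommRing R] {n : ℕ} (r : Fin n → R) :
    ∏ i : Fin n, ∏ j ∈ Finset.univ.filter (fun j => i < j), (r i - r j) ^ 2 =
      (Matrix.vandermonde r).det ^ 2 := by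
  simp_rw [Matrix.det_vandermonde, ← Finset.prod_pow]
  refine Finset.prod_congr rfl fun i _ => Finset.prod_congr (by ext; simp) fun j _ => by ring

/-- A ring endomorphism permuting the entries of a tuple multiplies its Vandermonde determinant
by the sign of the permutation. -/
theorem map_det_vandermonde_eq_sign_mul {R : Type*} [CommRing R] {n : ℕ} (φ : R →+* R)
    (r : Fin n → R) (σ : Equiv.Perm (Fin n)) (hσ : ∀ i, φ (r i) = r (σ i)) :
    φ (Matrix.vandermonde r).det = (Equiv.Perm.sign σ : ℤ) * (Matrix.vandermonde r).det := by
  rw [RingHom.map_det, ← Matrix.det_permute]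
  congr 1
  ext i j
  simp [Matrix.vandermonde_apply, hσ]

/-- The quadratic character of `d`, in terms of a nonzero square root `δ` of `d` in an extension
field on which the Frobenius map acts by a sign `s`. -/
theorem quadraticChar_eq_of_pow_card_eq {F K : Type*} [Field F] [Fintype F] [Field K]
    [Algebra F K] (hodd : Odd (Fintype.card F)) {d : F} {δ : K} (hδ : δ ≠ 0)
    (hd : algebraMap F K d = δ ^ 2) (s : ℤˣ) (hs : δ ^ Fintype.card F = (s : ℤ) * δ) :
    (s : ℤ) = quadraticChar F d := by
  have hF : ringChar F ≠ 2 := fun h => by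
    have := FiniteField.even_card_of_char_two h
    rw [Nat.odd_iff] at hodd
    omega
  have hd0 : d ≠ 0 := by
    rintro rfl
    exact pow_ne_zero 2 hδ (by simpa using hd.symm)
  have hpow : d ^ (Fintype.card F / 2) = ((s : ℤ) : F) := by
    apply (algebraMap F K).injective
    apply mul_right_cancel₀ hδ
    rw [map_pow, hd, ← pow_mul, ← pow_succ, Nat.two_mul_div_two_add_one_of_odd hodd, hs,
      map_intCast]
  rw [quadraticChar_eq_pow_of_char_ne_two hF hd0, hpow]
  have h1 : (-1 : F) ≠ 1 := Ring.neg_one_ne_one_of_char_ne_two hF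
  rcases Int.units_eq_one_or s with rfl | rfl <;> simp [h1]

/-- Let `q` be an odd prime power (realized as the cardinality of a finite field `F`) and
let `f` be a monic squarefree polynomial in `𝔽_q[T]`, with roots `r 0, …, r (n-1)` in an
algebraic closure. If `π` is the permutation of the set of roots of `f` induced by the
Frobenius map `α ↦ α^q`, then `sign(π) = χ(disc f)`, where `χ` is the quadratic character
on `𝔽_q` and `disc f = ∏_{i<j} (r i - r j)^2` is the discriminant of `f`, an element `d`
of `𝔽_q`. -/
theorem sign_frobenius_eq_quadraticChar_disc {F : Type*} [Field F] [Fintype F]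
    (hodd : Odd (Fintype.card F))
    (f : F[X]) (hf : f.Monic) (hsf : Squarefree f)
    (π : Equiv.Perm (f.rootSet (AlgebraicClosure F)))
    (hπ : ∀ x : f.rootSet (AlgebraicClosure F),
      (π x : AlgebraicClosure F) = (x : AlgebraicClosure F) ^ Fintype.card F)
    (r : Fin f.natDegree → AlgebraicClosure F)
    (hr : f.map (algebraMap F (AlgebraicClosure F)) = ∏ i, (X - C (r i)))
    (d : F)
    (hd : algebraMap F (AlgebraicClosure F) d =
      ∏ i : Fin f.natDegree, ∏ j ∈ Finset.univ.filter (fun j => i < j), (r i - r j) ^ 2) :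
    (Equiv.Perm.sign π : ℤ) = quadraticChar F d := by
  have hrinj : Function.Injective r := by
    rw [← separable_prod_X_sub_C_iff, ← hr]
    exact (PerfectField.separable_iff_squarefree.mpr hsf).map
  have hmem (x : AlgebraicClosure F) : x ∈ f.rootSet (AlgebraicClosure F) ↔ ∃ i, r i = x := by
    rw [mem_rootSet_of_ne hf.ne_zero, aeval_def, ← eval_map, hr, eval_prod,
      Finset.prod_eq_zero_iff]
    simp [sub_eq_zero, eq_comm]
  let e : Fin f.natDegree ≃ f.rootSet (AlgebraicClosure F) :=
    Equiv.ofBijective (fun i => ⟨r i, (hmem _).2 ⟨i, rfl⟩⟩)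
      ⟨fun i j h => hrinj (congrArg Subtype.val h), fun x => by
        obtain ⟨i, hi⟩ := (hmem x).1 x.2
        exact ⟨i, Subtype.ext hi⟩⟩
  have he (i) : (e i : AlgebraicClosure F) = r i := rfl
  let σ : Equiv.Perm (Fin f.natDegree) := (e.trans π).trans e.symm
  have hσ (i) : r i ^ Fintype.card F = r (σ i) := by
    rw [← he, ← he, ← hπ]
    simp [σ]
  have hsign : Equiv.Perm.sign σ = Equiv.Perm.sign π := Equiv.Perm.sign_symm_trans_trans π e.symm
  rw [← hsign]
  refine quadraticChar_eq_of_pow_card_eq hodd (Matrix.det_vandermonde_ne_zero_iff.2 hrinj)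
    (hd.trans (prod_sub_sq_eq_det_vandermonde_sq r)) _ ?_
  exact map_det_vandermonde_eq_sign_mul
    (FiniteField.frobeniusAlgHom F (AlgebraicClosure F)).toRingHom r σ hσ
end
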